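/- Let p be prime, n ≥ 1, let 1 < q, q₁, q₂ < ∞ with 1/q = 1/q₁ + 1/q₂, let ψ be a nonnegative measurable function on ℤ_p^* × ℤ_p^*, and let f₁, f₂ be nonnegative measurable functions on ℚ_p^n. For t ∈ ℤ_p^* write v(t) ∈ ℤ_{≥0} for the integer with |t|_p = p^{−v(t)}. Then for every k ∈ ℤ, ‖H^{p,2}_ψ(f₁,f₂) χ_k‖_{L^q(ℚ_p^n)} ≤ ∫_{ℤ_p^*}∫_{ℤ_p^*} ‖f₁ χ_{k−v(t₁)}‖_{L^{q₁}(ℚ_p^n)} · ‖f₂ χ_{k−v(t₂)}‖_{L^{q₂}(ℚ_p^n)} · |t₁|_p^{−n/q₁} |t₂|_p^{−n/q₂} ψ(t₁,t₂) dt₁ dt₂. -/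

import Mathlib

open MeasureTheory
open scoped ENNReal

noncomputable section

variable (p : ℕ) [Fact p.Prime]

instance padicMeasurableSpace : MeasurableSpace ℚ_[p] := borel _
instance padicBorelSpace : BorelSpace ℚ_[p] := ⟨rfl⟩

/-- The closed unit ball of `ℚ_[p]` as a positive compact set. -/
def padicUnitBall : TopologicalSpace.PositiveCompacts ℚ_[p] where
  carrier := Metric.closedBall 0 1
  isCompact' := isCompact_closedBall 0 1
  interior_nonempty' :=
    ⟨0, mem_interior_iff_mem_nhds.mpr
      (Filter.mem_of_superset (Metric.ball_mem_nhds 0 one_pos) Metric.ball_subset_closedBall)⟩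

/-- Haar measure on `ℚ_[p]` normalized so that `ℤ_p` has measure 1. -/
def padicHaar : Measure ℚ_[p] := Measure.addHaarMeasure (padicUnitBall p)

instance : SigmaFinite (padicHaar p) := by
  unfold padicHaar; infer_instance

/-- Normalized Haar measure on `ℚ_[p]^n` (the product measure), for which the
unit ball has measure 1. -/
def padicHaarPi (n : ℕ) : Measure (Fin n → ℚ_[p]) := Measure.pi fun _ => padicHaar p

/-- `ℤ_p^* = {t : 0 < |t|_p ≤ 1}`. -/
def Zpstar : Set ℚ_[p] := {t | t ≠ 0 ∧ ‖t‖ ≤ 1}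

/-- `(ℤ_p^*)^m`. -/
def ZpstarPi (m : ℕ) : Set (Fin m → ℚ_[p]) := Set.univ.pi fun _ => Zpstar p

/-- The sphere `S_k = {x ∈ ℚ_p^n : |x|_p = p^k}`. -/
def padicSphere (n : ℕ) (k : ℤ) : Set (Fin n → ℚ_[p]) := {x | ‖x‖ = (p : ℝ) ^ k}

/-- `‖f χ_k‖_{L^q}` for a nonnegative (ℝ≥0∞-valued) function. -/
def lqNormSphere (n : ℕ) (q : ℝ) (k : ℤ) (f : (Fin n → ℚ_[p]) → ℝ≥0∞) : ℝ≥0∞ :=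
  (∫⁻ x in padicSphere p n k, f x ^ q ∂ padicHaarPi p n) ^ (1 / q)

/-- The homogeneous p-adic Herz norm `‖f‖_{K̇^{α,r}_q}`. -/
def herzNorm (n : ℕ) (α r q : ℝ) (f : (Fin n → ℚ_[p]) → ℝ≥0∞) : ℝ≥0∞ :=
  (∑' k : ℤ, (p : ℝ≥0∞) ^ ((k : ℝ) * α * r) * lqNormSphere p n q k f ^ r) ^ (1 / r)

/-- The homogeneous p-adic Morrey–Herz norm `‖f‖_{MK̇^{α,λ}_{r,q}}`. -/
def morreyHerzNorm (n : ℕ) (α lam r q : ℝ) (f : (Fin n → ℚ_[p]) → ℝ≥0∞) : ℝ≥0∞ :=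
  ⨆ k₀ : ℤ, (p : ℝ≥0∞) ^ (-(k₀ : ℝ) * lam) *
    (∑' k : {k : ℤ // k ≤ k₀},
      (p : ℝ≥0∞) ^ (((k : ℤ) : ℝ) * α * r) * lqNormSphere p n q (k : ℤ) f ^ r) ^ (1 / r)

/-- The weighted multilinear p-adic Hardy operator `H^{p,m}_ψ`. -/
def multilinearHardy (n m : ℕ) (ψ : (Fin m → ℚ_[p]) → ℝ≥0∞)
    (f : Fin m → (Fin n → ℚ_[p]) → ℝ≥0∞) (x : Fin n → ℚ_[p]) : ℝ≥0∞ :=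
  ∫⁻ t in ZpstarPi p m, (∏ i, f i (t i • x)) * ψ t ∂ padicHaarPi p m

/-- The dual weighted multilinear p-adic Hardy operator `H^{p,m,*}_ψ`. -/
def multilinearHardyDual (n m : ℕ) (ψ : (Fin m → ℚ_[p]) → ℝ≥0∞)
    (f : Fin m → (Fin n → ℚ_[p]) → ℝ≥0∞) (x : Fin n → ℚ_[p]) : ℝ≥0∞ :=
  ∫⁻ t in ZpstarPi p m,
      (∏ i, f i ((((padicNormE (t i) : ℚ)⁻¹ : ℚ_[p])) • x)) *
        (∏ i, ENNReal.ofReal ‖t i‖ ^ (-(n : ℝ))) * ψ t ∂ padicHaarPi p m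


/-- **Minkowski's integral inequality**: the `L^q` norm of an integral is at most the integral of
the `L^q` norms. -/
theorem lintegral_rpow_lintegral_le {α β : Type*} [MeasurableSpace α] [MeasurableSpace β]
    {μ : Measure α} {ν : Measure β} [SigmaFinite μ] [SFinite ν] {q : ℝ} (hq : 1 < q)
    {F : β → α → ℝ≥0∞} (hF : Measurable (Function.uncurry F)) :
    (∫⁻ x, (∫⁻ t, F t x ∂ν) ^ q ∂μ) ^ (1 / q) ≤ ∫⁻ t, (∫⁻ x, F t x ^ q ∂μ) ^ (1 / q) ∂ν := by
  have hq0 : 0 < q := by linarith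
  have hpq : q.HolderConjugate q.conjExponent := .conjExponent hq
  set G : α → ℝ≥0∞ := fun x => ∫⁻ t, F t x ∂ν with hG
  have hGm : Measurable G := Measurable.lintegral_prod_left' hF
  have key : ∀ h : α → ℝ≥0∞, Measurable h → (∀ x, h x ≤ G x) → ∫⁻ x, h x ^ q ∂μ ≠ ∞ →
      ∫⁻ x, h x ^ q ∂μ ≤ (∫⁻ t, (∫⁻ x, F t x ^ q ∂μ) ^ (1 / q) ∂ν) ^ q := by
    intro h hm hle hfin
    by_cases h0 : ∫⁻ x, h x ^ q ∂μ = 0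
    · simp [h0]
    set I := ∫⁻ x, h x ^ q ∂μ with hI
    have hconj : (q - 1) * q.conjExponent = q := hpq.sub_one_mul_conj
    have step : I ≤ (∫⁻ t, (∫⁻ x, F t x ^ q ∂μ) ^ (1 / q) ∂ν) * I ^ (1 / q.conjExponent) := by
      calc I ≤ ∫⁻ x, G x * h x ^ (q - 1) ∂μ := by
            refine lintegral_mono fun x => ?_
            calc h x ^ q = h x ^ (1 + (q - 1)) := by ring_nf
              _ = h x * h x ^ (q - 1) := by
                rw [ENNReal.rpow_add_of_nonneg _ _ zero_le_one (by linarith), ENNReal.rpow_one]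
              _ ≤ _ := by gcongr; exact hle x
        _ = ∫⁻ x, ∫⁻ t, F t x * h x ^ (q - 1) ∂ν ∂μ := by
            refine lintegral_congr fun x => ?_
            exact (lintegral_mul_const _ (hF.comp measurable_prodMk_right)).symm
        _ = ∫⁻ t, ∫⁻ x, F t x * h x ^ (q - 1) ∂μ ∂ν := by
            refine lintegral_lintegral_swap (Measurable.aemeasurable ?_)
            exact (hF.comp measurable_swap).mul ((hm.comp measurable_fst).pow_const _)
        _ ≤ ∫⁻ t, (∫⁻ x, F t x ^ q ∂μ) ^ (1 / q) * I ^ (1 / q.conjExponent) ∂ν := by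
            refine lintegral_mono fun t => ?_
            refine (ENNReal.lintegral_mul_le_Lp_mul_Lq μ hpq
              (hF.comp measurable_prodMk_left).aemeasurable
              (hm.pow_const (q - 1)).aemeasurable).trans_eq ?_
            simp_rw [← ENNReal.rpow_mul, hconj]
            rfl
        _ = _ := lintegral_mul_const' _ _
            (ENNReal.rpow_ne_top_of_nonneg (one_div_nonneg.2 hpq.symm.nonneg) hfin)
    rw [← ENNReal.rpow_inv_le_iff hq0, ← one_div]
    have hsum : 1 / q + 1 / q.conjExponent = 1 := by
      simpa [one_div] using hpq.inv_add_inv_eq_one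
    have hsplit : I = I ^ (1 / q) * I ^ (1 / q.conjExponent) := by
      rw [← ENNReal.rpow_add _ _ h0 hfin, hsum, ENNReal.rpow_one]
    replace step := hsplit.symm.trans_le step
    refine (ENNReal.mul_le_mul_iff_left ?_ ?_).1 step
    · exact (ENNReal.rpow_pos (pos_iff_ne_zero.2 h0) hfin).ne'
    · exact ENNReal.rpow_ne_top_of_nonneg (one_div_nonneg.2 hpq.symm.nonneg) hfin
  rw [one_div, ENNReal.rpow_inv_le_iff hq0, ← one_div]
  set h : ℕ → α → ℝ≥0∞ := fun k => (spanningSets μ k).indicator fun x => min (G x) k with hh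
  have hmeas : ∀ k, Measurable (h k) := fun k =>
    (hGm.min measurable_const).indicator (measurableSet_spanningSets μ k)
  have hmono : Monotone h := by
    intro i j hij x
    by_cases hx : x ∈ spanningSets μ i
    · have hx' := monotone_spanningSets μ hij hx
      simp only [hh, Set.indicator_of_mem hx, Set.indicator_of_mem hx']
      gcongr
    · simp [hh, Set.indicator_of_notMem hx]
  have hleG : ∀ k x, h k x ≤ G x := fun k x =>
    (Set.indicator_le_self' (fun _ _ => zero_le) x).trans (min_le_left _ _)
  have hsup : ∀ x, G x ^ q ≤ ⨆ k, h k x ^ q := by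
    intro x
    have hlim : Filter.Tendsto (fun k : ℕ => min (G x) k ^ q) Filter.atTop (nhds (G x ^ q)) := by
      have := (tendsto_const_nhds (x := G x)).min ENNReal.tendsto_nat_nhds_top
      rw [min_top_right] at this
      exact (ENNReal.continuous_rpow_const.tendsto _).comp this
    refine le_of_tendsto hlim ?_
    filter_upwards [Filter.eventually_ge_atTop (spanningSetsIndex μ x)] with k hk
    refine le_iSup_of_le k ?_
    rw [hh]
    simp only
    rw [Set.indicator_of_mem (mem_spanningSets_of_index_le μ x hk)]
  calc ∫⁻ x, G x ^ q ∂μ ≤ ∫⁻ x, ⨆ k, h k x ^ q ∂μ := lintegral_mono hsup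
    _ = ⨆ k, ∫⁻ x, h k x ^ q ∂μ := lintegral_iSup (fun k => (hmeas k).pow_const _)
        fun i j hij x => ENNReal.rpow_le_rpow (hmono hij x) hq0.le
    _ ≤ _ := iSup_le fun k => key (h k) (hmeas k) (hleG k) (ne_of_lt ?_)
  calc ∫⁻ x, h k x ^ q ∂μ
      ≤ ∫⁻ x, (spanningSets μ k).indicator (fun _ => (k : ℝ≥0∞) ^ q) x ∂μ := by
        refine lintegral_mono fun x => ?_
        by_cases hx : x ∈ spanningSets μ k
        · simp only [hh, Set.indicator_of_mem hx]
          gcongr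
          exact min_le_right _ _
        · simp [hh, Set.indicator_of_notMem hx, hq0]
    _ = (k : ℝ≥0∞) ^ q * μ (spanningSets μ k) :=
        lintegral_indicator_const (measurableSet_spanningSets μ k) _
    _ < ∞ := ENNReal.mul_lt_top (ENNReal.rpow_lt_top_of_nonneg hq0.le (ENNReal.natCast_ne_top k))
        (measure_spanningSets_lt_top μ k)

section Scaling

open scoped Pointwise NNReal

variable (p : ℕ) [Fact p.Prime]

instance : (padicHaar p).IsAddHaarMeasure := by
  unfold padicHaar; infer_instance

instance : (padicHaar p).Regular := by
  unfold padicHaar; infer_instance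

theorem padicHaar_closedBall_one : padicHaar p (Metric.closedBall 0 1) = 1 :=
  Measure.addHaarMeasure_self (K₀ := padicUnitBall p)

/-- The unit ball of `ℚ_[p]` is the disjoint union of `p` translates of the open unit ball. -/
theorem padicHaar_ball_one : (p : ℝ≥0∞) * padicHaar p (Metric.ball 0 1) = 1 := by
  have hunion : Metric.closedBall (0 : ℚ_[p]) 1 =
      ⋃ i ∈ Finset.range p, Metric.ball (i : ℚ_[p]) 1 := by
    ext x
    simp only [mem_closedBall_zero_iff, Set.mem_iUnion, Finset.mem_range, exists_prop,
      Metric.mem_ball, dist_eq_norm]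
    constructor
    · intro hx
      exact ⟨_, PadicInt.zmodRepr_lt_p (⟨x, hx⟩ : ℤ_[p]),
        PadicInt.norm_sub_zmodRepr_lt_one (⟨x, hx⟩ : ℤ_[p])⟩
    · rintro ⟨i, -, hi⟩
      calc ‖x‖ = ‖(x - i) + i‖ := by simp
        _ ≤ max ‖x - i‖ ‖(i : ℚ_[p])‖ := Padic.nonarchimedean _ _
        _ ≤ 1 := max_le hi.le (by simpa using Padic.norm_int_le_one (p := p) i)
  have hdisj : Set.PairwiseDisjoint (↑(Finset.range p))
      fun i : ℕ => Metric.ball (i : ℚ_[p]) 1 := by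
    intro i hi j hj hij
    refine Set.disjoint_left.2 fun x hxi hxj => hij ?_
    rw [Metric.mem_ball, dist_eq_norm] at hxi hxj
    have hlt : ‖((i - j : ℤ) : ℚ_[p])‖ < 1 := by
      calc ‖((i - j : ℤ) : ℚ_[p])‖ = ‖(x - j) + -(x - i)‖ := by push_cast; ring_nf
        _ ≤ max ‖x - j‖ ‖-(x - i)‖ := Padic.nonarchimedean _ _
        _ < 1 := max_lt hxj (by rwa [norm_neg])
    rw [Padic.norm_intCast_lt_one_iff] at hlt
    have hi' := Finset.mem_range.1 (Finset.mem_coe.1 hi)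
    have hj' := Finset.mem_range.1 (Finset.mem_coe.1 hj)
    have := Int.eq_zero_of_abs_lt_dvd hlt (by rw [abs_lt]; omega)
    omega
  have htrans : ∀ i : ℕ,
      padicHaar p (Metric.ball (i : ℚ_[p]) 1) = padicHaar p (Metric.ball 0 1) := fun i =>
    Measure.addHaar_ball_center _ _ _
  rw [← padicHaar_closedBall_one p, hunion,
    measure_biUnion_finset hdisj fun _ _ => measurableSet_ball]
  simp [htrans]

theorem distribHaarChar_padic_of_norm_eq_one (u : ℚ_[p]ˣ) (hu : ‖(u : ℚ_[p])‖ = 1) :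
    distribHaarChar ℚ_[p] u = 1 := by
  refine distribHaarChar_eq_of_measure_smul_eq_mul (μ := padicHaar p)
    (s := Metric.closedBall 0 1) (by simp [padicHaar_closedBall_one])
    (by simp [padicHaar_closedBall_one]) ?_
  have : u • Metric.closedBall (0 : ℚ_[p]) 1 = Metric.closedBall 0 1 := by
    change (u : ℚ_[p]) • Metric.closedBall (0 : ℚ_[p]) 1 = _
    rw [smul_closedBall' u.ne_zero]
    simp [hu]
  simp [this]

theorem distribHaarChar_padic_prime (u : ℚ_[p]ˣ) (hu : (u : ℚ_[p]) = p) :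
    distribHaarChar ℚ_[p] u = (p : ℝ≥0)⁻¹ := by
  have hp : (p : ℝ≥0) ≠ 0 := by exact_mod_cast (Fact.out : p.Prime).ne_zero
  refine distribHaarChar_eq_of_measure_smul_eq_mul (μ := padicHaar p)
    (s := Metric.closedBall 0 1) (by simp [padicHaar_closedBall_one])
    (by simp [padicHaar_closedBall_one]) ?_
  have hball : u • Metric.closedBall (0 : ℚ_[p]) 1 = Metric.ball 0 1 := by
    change (u : ℚ_[p]) • Metric.closedBall (0 : ℚ_[p]) 1 = _
    rw [smul_closedBall' u.ne_zero]
    ext x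
    have := Padic.norm_le_pow_iff_norm_lt_pow_add_one x (-1)
    simpa [hu] using this
  rw [hball, padicHaar_closedBall_one, mul_one, ENNReal.coe_inv hp]
  exact ENNReal.eq_inv_of_mul_eq_one_left ((mul_comm _ _).trans (padicHaar_ball_one p))

/-- The modulus of multiplication by `u` on `ℚ_[p]` is the `p`-adic norm of `u`. -/
theorem distribHaarChar_padic (u : ℚ_[p]ˣ) : distribHaarChar ℚ_[p] u = ‖(u : ℚ_[p])‖₊ := by
  have hp : (p : ℚ_[p]) ≠ 0 := by exact_mod_cast (Fact.out : p.Prime).ne_zero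
  set π : ℚ_[p]ˣ := Units.mk0 (p : ℚ_[p]) hp
  set v := (u : ℚ_[p]).valuation
  have hpR : (p : ℝ) ≠ 0 := by exact_mod_cast (Fact.out : p.Prime).ne_zero
  have hnorm : ‖(u : ℚ_[p])‖ = (p : ℝ) ^ (-v) := Padic.norm_eq_zpow_neg_valuation u.ne_zero
  have hunit : ‖((u * (π ^ v)⁻¹ : ℚ_[p]ˣ) : ℚ_[p])‖ = 1 := by
    simp only [Units.val_mul, Units.val_inv_eq_inv_val, Units.val_zpow_eq_zpow_val, norm_mul,
      norm_inv, hnorm]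
    change (p : ℝ) ^ (-v) * (‖(p : ℚ_[p]) ^ v‖)⁻¹ = 1
    rw [Padic.norm_p_zpow]
    exact mul_inv_cancel₀ (zpow_ne_zero _ hpR)
  have hu : u = (u * (π ^ v)⁻¹) * π ^ v := by simp
  rw [hu, map_mul, distribHaarChar_padic_of_norm_eq_one p _ hunit, map_zpow,
    distribHaarChar_padic_prime p π rfl, one_mul, ← hu]
  ext
  simp [hnorm]

theorem map_mul_left_padicHaar {t : ℚ_[p]} (ht : t ≠ 0) :
    (padicHaar p).map (t * ·) = (ENNReal.ofReal ‖t‖)⁻¹ • padicHaar p := by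
  ext s hs
  rw [Measure.map_apply (measurable_const_mul t) hs]
  have hpre : (t * ·) ⁻¹' s = (Units.mk0 t ht)⁻¹ • s := by
    rw [← Set.preimage_smul]; rfl
  rw [hpre, ← distribHaarChar_mul, distribHaarChar_padic]
  have : ‖t‖₊ ≠ 0 := by simpa using ht
  simp [ENNReal.coe_inv this, ENNReal.ofReal, norm_toNNReal]

theorem map_smul_padicHaarPi (n : ℕ) {t : ℚ_[p]} (ht : t ≠ 0) :
    (padicHaarPi p n).map (t • ·) = (ENNReal.ofReal ‖t‖)⁻¹ ^ n • padicHaarPi p n := by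
  have hsf : SigmaFinite ((padicHaar p).map (t * ·)) :=
    (MeasurableEquiv.mulLeft₀ t ht).sigmaFinite_map
  have hmap : (padicHaarPi p n).map (t • ·) =
      Measure.pi fun _ : Fin n => (padicHaar p).map (t * ·) :=
    Measure.pi_map_pi (μ := fun _ : Fin n => padicHaar p) (f := fun _ => (t * ·))
      fun _ => (measurable_const_mul t).aemeasurable
  rw [hmap]
  refine (Measure.pi_eq fun s _ => ?_)
  simp [map_mul_left_padicHaar p ht, padicHaarPi, Finset.prod_mul_distrib]

theorem measurableSet_padicSphere (n : ℕ) (k : ℤ) : MeasurableSet (padicSphere p n k) :=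
  measurableSet_eq_fun continuous_norm.measurable measurable_const

theorem measurableSet_ZpstarPi (m : ℕ) : MeasurableSet (ZpstarPi p m) := by
  refine MeasurableSet.univ_pi fun _ => ?_
  exact (measurableSet_singleton (0 : ℚ_[p])).compl.inter
    (measurableSet_le measurable_norm measurable_const)

instance (n : ℕ) : SigmaFinite (padicHaarPi p n) := by
  unfold padicHaarPi; infer_instance

/-- The behaviour of the `L^q` norm on spheres under dilations. -/
theorem lqNormSphere_comp_smul (n : ℕ) {q : ℝ} (hq : 0 < q) (k : ℤ)
    {f : (Fin n → ℚ_[p]) → ℝ≥0∞} (hf : Measurable f) {t : ℚ_[p]} (ht : t ≠ 0) :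
    lqNormSphere p n q k (fun x => f (t • x)) =
      lqNormSphere p n q (k - t.valuation) f * ENNReal.ofReal ‖t‖ ^ (-(n : ℝ) / q) := by
  have hpR : (p : ℝ) ≠ 0 := by exact_mod_cast (Fact.out : p.Prime).ne_zero
  have hpre : padicSphere p n k = (t • ·) ⁻¹' padicSphere p n (k - t.valuation) := by
    ext x
    simp only [padicSphere, Set.mem_ofPred_eq, Set.mem_preimage, norm_smul,
      Padic.norm_eq_zpow_neg_valuation ht]
    rw [sub_eq_neg_add, zpow_add₀ hpR, mul_right_inj' (zpow_ne_zero _ hpR)]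
  have hsmul : Measurable fun x : Fin n → ℚ_[p] => t • x := measurable_const_smul t
  have hint : ∫⁻ x in padicSphere p n k, f (t • x) ^ q ∂padicHaarPi p n =
      (ENNReal.ofReal ‖t‖)⁻¹ ^ n *
        ∫⁻ x in padicSphere p n (k - t.valuation), f x ^ q ∂padicHaarPi p n := by
    rw [hpre, ← setLIntegral_map (measurableSet_padicSphere p n _) (hf.pow_const q) hsmul,
      map_smul_padicHaarPi p n ht, Measure.restrict_smul, lintegral_smul_measure, smul_eq_mul]
  have hexp : ((ENNReal.ofReal ‖t‖)⁻¹ ^ n) ^ (1 / q) = ENNReal.ofReal ‖t‖ ^ (-(n : ℝ) / q) := by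
    rw [← ENNReal.rpow_natCast, ← ENNReal.rpow_mul, ENNReal.inv_rpow, ← ENNReal.rpow_neg]
    congr 1
    ring
  rw [lqNormSphere, lqNormSphere, hint, ENNReal.mul_rpow_of_nonneg _ _ (by positivity), hexp,
    mul_comm]

end Scaling

/-- The key pointwise-on-spheres estimate in the proof of Theorem 2.1 (case `m = 2`):
the `L^q` norm of `H^{p,2}_ψ(f₁,f₂) χ_k` is controlled by a weighted integral of
shifted `L^{q_i}` norms of the `f_i`. Here `v(t) = t.valuation` is the integer with
`|t|_p = p^{-v(t)}`. -/
theorem statement8 (p n : ℕ) [Fact p.Prime] (hn : 1 ≤ n)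
    (q q₁ q₂ : ℝ) (hq : 1 < q) (hq₁ : 1 < q₁) (hq₂ : 1 < q₂)
    (hqs : 1 / q = 1 / q₁ + 1 / q₂)
    (ψ : (Fin 2 → ℚ_[p]) → ℝ≥0∞) (hψ : Measurable ψ)
    (f₁ f₂ : (Fin n → ℚ_[p]) → ℝ≥0∞) (hf₁ : Measurable f₁) (hf₂ : Measurable f₂)
    (k : ℤ) :
    lqNormSphere p n q k (multilinearHardy p n 2 ψ ![f₁, f₂])
      ≤ ∫⁻ t in ZpstarPi p 2,
          lqNormSphere p n q₁ (k - (t 0).valuation) f₁ *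
            lqNormSphere p n q₂ (k - (t 1).valuation) f₂ *
            (ENNReal.ofReal ‖t 0‖ ^ (-(n : ℝ) / q₁) *
              ENNReal.ofReal ‖t 1‖ ^ (-(n : ℝ) / q₂)) * ψ t ∂ padicHaarPi p 2 := by
  have hq0 : 0 < q := by linarith
  have hq₁q : q < q₁ := by
    refine lt_of_one_div_lt_one_div (by linarith) ?_
    rw [hqs]
    have : 0 < 1 / q₂ := by positivity
    linarith
  have hsmul : ∀ i : Fin 2, Measurable
      fun z : (Fin 2 → ℚ_[p]) × (Fin n → ℚ_[p]) => z.1 i • z.2 := fun i =>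
    ((measurable_pi_apply i).comp measurable_fst).smul measurable_snd
  have hF : Measurable (Function.uncurry fun (t : Fin 2 → ℚ_[p]) (x : Fin n → ℚ_[p]) =>
      f₁ (t 0 • x) * f₂ (t 1 • x) * ψ t) :=
    ((hf₁.comp (hsmul 0)).mul (hf₂.comp (hsmul 1))).mul (hψ.comp measurable_fst)
  have hop : multilinearHardy p n 2 ψ ![f₁, f₂] = fun x =>
      ∫⁻ t in ZpstarPi p 2, f₁ (t 0 • x) * f₂ (t 1 • x) * ψ t ∂padicHaarPi p 2 := by
    funext x
    simp [multilinearHardy, Fin.prod_univ_two]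
  rw [hop]
  refine (lintegral_rpow_lintegral_le hq hF).trans ?_
  refine setLIntegral_mono' (measurableSet_ZpstarPi p 2) fun t ht => ?_
  have ht0 : ∀ i, t i ≠ 0 := fun i => (ht i (Set.mem_univ i)).1
  have hm₁ : Measurable fun x => f₁ (t 0 • x) := hf₁.comp (measurable_const_smul _)
  have hm₂ : Measurable fun x => f₂ (t 1 • x) := hf₂.comp (measurable_const_smul _)
  have hpull : (∫⁻ x in padicSphere p n k, (f₁ (t 0 • x) * f₂ (t 1 • x) * ψ t) ^ q
      ∂padicHaarPi p n) ^ (1 / q) =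
      (∫⁻ x in padicSphere p n k, (f₁ (t 0 • x) * f₂ (t 1 • x)) ^ q
        ∂padicHaarPi p n) ^ (1 / q) * ψ t := by
    have hm : Measurable fun x => (f₁ (t 0 • x) * f₂ (t 1 • x)) ^ q := (hm₁.mul hm₂).pow_const q
    simp_rw [ENNReal.mul_rpow_of_nonneg _ (ψ t) hq0.le]
    rw [lintegral_mul_const _ hm,
      ENNReal.mul_rpow_of_nonneg _ _ (by positivity), ← ENNReal.rpow_mul,
      mul_one_div_cancel hq0.ne', ENNReal.rpow_one]
  rw [hpull]
  gcongr
  refine (ENNReal.lintegral_Lp_mul_le_Lq_mul_Lr hq0 hq₁q hqs _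
    hm₁.aemeasurable hm₂.aemeasurable).trans_eq ?_
  change lqNormSphere p n q₁ k (fun x => f₁ (t 0 • x)) *
    lqNormSphere p n q₂ k (fun x => f₂ (t 1 • x)) = _
  rw [lqNormSphere_comp_smul p n (by linarith) k hf₁ (ht0 0),
    lqNormSphere_comp_smul p n (by linarith) k hf₂ (ht0 1), mul_mul_mul_comm]

end
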